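/- arXiv:2411.01638 — 9 statements merged into one kernel-verified Lean document; each statement's English description precedes it below -/
import Mathlib

section
/- For any integer r and any non-negative integer k, each component of the k-th power of (1, 1, 0) under ×_r satisfies the third-order linear recurrence with characteristic polynomial t³ − 3t² + 3t − (r + 1); that is, x_{k+3} = 3x_{k+2} − 3x_{k+1} + (r + 1)x_k, y_{k+3} = 3y_{k+2} − 3y_{k+1} + (r + 1)y_k, and z_{k+3} = 3z_{k+2} − 3z_{k+1} + (r + 1)z_k. -/
/-- The product `×_r` on `ℤ³`. -/
def pellMul (r : ℤ) (a b : ℤ × ℤ × ℤ) : ℤ × ℤ × ℤ :=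
  (a.1 * b.1 + r * (a.2.1 * b.2.2 + a.2.2 * b.2.1),
   a.1 * b.2.1 + a.2.1 * b.1 + r * a.2.2 * b.2.2,
   a.1 * b.2.2 + a.2.1 * b.2.1 + a.2.2 * b.1)

/-- The `k`-th power of `(1, 1, 0)` under `×_r`. -/
def pellPow (r : ℤ) : ℕ → ℤ × ℤ × ℤ
  | 0 => (1, 0, 0)
  | k + 1 => pellMul r (1, 1, 0) (pellPow r k)

theorem stmt_3 (r : ℤ) (k : ℕ) :
    (pellPow r (k + 3)).1
        = 3 * (pellPow r (k + 2)).1 - 3 * (pellPow r (k + 1)).1 + (r + 1) * (pellPow r k).1 ∧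
    (pellPow r (k + 3)).2.1
        = 3 * (pellPow r (k + 2)).2.1 - 3 * (pellPow r (k + 1)).2.1 + (r + 1) * (pellPow r k).2.1 ∧
    (pellPow r (k + 3)).2.2
        = 3 * (pellPow r (k + 2)).2.2 - 3 * (pellPow r (k + 1)).2.2 + (r + 1) * (pellPow r k).2.2 := by
  simp only [pellPow, pellMul]
  refine ⟨?_, ?_, ?_⟩ <;> ring
end

section
/- For any integer r and any non-negative integer k, the Pell-X, Pell-Y and Pell-Z sequences of parameter r coincide with the components of the k-th power of (1, 1, 0) under ×_r: X_k(r) = x_k, Y_k(r) = y_k, and Z_k(r) = z_k. -/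
/-- The Pell-X sequence of parameter `r`. -/
def pellX (r : ℤ) : ℕ → ℤ
  | 0 => 1
  | 1 => 1
  | 2 => 1
  | n + 3 => 3 * pellX r (n + 2) - 3 * pellX r (n + 1) + (r + 1) * pellX r n

/-- The Pell-Y sequence of parameter `r`. -/
def pellY (r : ℤ) : ℕ → ℤ
  | 0 => 0
  | 1 => 1
  | 2 => 2
  | n + 3 => 3 * pellY r (n + 2) - 3 * pellY r (n + 1) + (r + 1) * pellY r n

/-- The Pell-Z sequence of parameter `r`. -/
def pellZ (r : ℤ) : ℕ → ℤ
  | 0 => 0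
  | 1 => 0
  | 2 => 1
  | n + 3 => 3 * pellZ r (n + 2) - 3 * pellZ r (n + 1) + (r + 1) * pellZ r n

theorem pellPow_succ (r : ℤ) (k : ℕ) :
    pellPow r (k + 1) = ((pellPow r k).1 + r * (pellPow r k).2.2,
      (pellPow r k).1 + (pellPow r k).2.1, (pellPow r k).2.1 + (pellPow r k).2.2) := by
  ext <;> simp [pellPow, pellMul] <;> ring

theorem stmt_4 (r : ℤ) (k : ℕ) :
    pellX r k = (pellPow r k).1 ∧ pellY r k = (pellPow r k).2.1 ∧
      pellZ r k = (pellPow r k).2.2 := by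
  induction k using Nat.strong_induction_on with
  | _ k ih =>
    match k, ih with
    | 0, _ => simp [pellX, pellY, pellZ, pellPow]
    | 1, _ => simp [pellX, pellY, pellZ, pellPow, pellMul]
    | 2, _ => simp [pellX, pellY, pellZ, pellPow, pellMul]
    | n + 3, ih =>
      obtain ⟨hx₀, hy₀, hz₀⟩ := ih n (by omega)
      obtain ⟨hx₁, hy₁, hz₁⟩ := ih (n + 1) (by omega)
      obtain ⟨hx₂, hy₂, hz₂⟩ := ih (n + 2) (by omega)
      simp only [pellX, pellY, pellZ, hx₀, hy₀, hz₀, hx₁, hy₁, hz₁, hx₂, hy₂, hz₂, pellPow_succ]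
      refine ⟨?_, ?_, ?_⟩ <;> ring
end

section
/- Let r be a positive integer, let ρ be the real cube root of r, and let ω be a primitive complex cube root of unity. Then for every non-negative integer n, the Pell-X sequence of parameter r satisfies the Binet formula X_n(r) = ((ρ + 1)ⁿ + (ωρ + 1)ⁿ + (ω²ρ + 1)ⁿ)/3 in ℂ. -/
theorem add_one_pow_add_three {R : Type*} [CommRing R] {x s : R} (hx : x ^ 3 = s) (n : ℕ) :
    (x + 1) ^ (n + 3)
      = 3 * (x + 1) ^ (n + 2) - 3 * (x + 1) ^ (n + 1) + (s + 1) * (x + 1) ^ n := by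
  subst hx
  ring

theorem stmt_5 (r : ℤ) (hr : 0 < r) (ρ : ℝ) (hρ : ρ ^ 3 = (r : ℝ))
    (ω : ℂ) (hω : IsPrimitiveRoot ω 3) (n : ℕ) :
    (pellX r n : ℂ)
      = (((ρ : ℂ) + 1) ^ n + (ω * (ρ : ℂ) + 1) ^ n + (ω ^ 2 * (ρ : ℂ) + 1) ^ n) / 3 := by
  have hρ' : (ρ : ℂ) ^ 3 = (r : ℂ) := by exact_mod_cast congrArg ((↑) : ℝ → ℂ) hρ
  have hω3 : ω ^ 3 = 1 := hω.pow_eq_one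
  have hsum : 1 + ω + ω ^ 2 = 0 := by
    simpa [Finset.sum_range_succ] using hω.geom_sum_eq_zero (by norm_num)
  have h₁ : (ω * (ρ : ℂ)) ^ 3 = (r : ℂ) := by rw [mul_pow, hω3, hρ', one_mul]
  have h₂ : (ω ^ 2 * (ρ : ℂ)) ^ 3 = (r : ℂ) := by
    rw [mul_pow, ← pow_mul, mul_comm 2 3, pow_mul, hω3, hρ', one_pow, one_mul]
  induction n using pellX.induct with
  | case1 => norm_num [pellX]
  | case2 =>
    simp only [pellX]
    push_cast
    linear_combination (-(ρ : ℂ) / 3) * hsum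
  | case3 =>
    simp only [pellX]
    push_cast
    linear_combination (-2 * (ρ : ℂ) / 3 - (ρ : ℂ) ^ 2 / 3) * hsum - (ρ : ℂ) ^ 2 * ω / 3 * hω3
  | case4 n ih₂ ih₁ ih₀ =>
    simp only [pellX]
    push_cast
    rw [ih₂, ih₁, ih₀, add_one_pow_add_three hρ', add_one_pow_add_three h₁,
      add_one_pow_add_three h₂]
    ring
end

section
/- Let r be a positive integer, let ρ be the real cube root of r, and let ω be a primitive complex cube root of unity. Then for every non-negative integer n, the Pell-Y sequence of parameter r satisfies the Binet formula Y_n(r) = ((ρ + 1)ⁿ·ω + (ωρ + 1)ⁿ + (ω²ρ + 1)ⁿ·ω²)/(3ωρ) in ℂ. -/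
/-- If `(x - 1) ^ 3 = s`, then the powers of `x` satisfy the Pell recurrence of parameter `s`. -/
theorem pow_add_three_of_sub_one_pow_three {R : Type*} [CommRing R] {x s : R}
    (h : (x - 1) ^ 3 = s) (n : ℕ) :
    x ^ (n + 3) = 3 * x ^ (n + 2) - 3 * x ^ (n + 1) + (s + 1) * x ^ n := by
  rw [← h]
  ring

/-- The Binet formula for `pellY`, cleared of denominators. -/
theorem pellY_mul_eq {R : Type*} [CommRing R] (r : ℤ) {ρ ω : R} (hρ : ρ ^ 3 = r)
    (hω : 1 + ω + ω ^ 2 = 0) (n : ℕ) :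
    (pellY r n : R) * (3 * ω * ρ)
      = (ρ + 1) ^ n * ω + (ω * ρ + 1) ^ n + (ω ^ 2 * ρ + 1) ^ n * ω ^ 2 := by
  have hω3 : ω ^ 3 = 1 := by linear_combination (ω - 1) * hω
  have h₀ : (ρ + 1 - 1) ^ 3 = (r : R) := by rw [← hρ]; ring
  have h₁ : (ω * ρ + 1 - 1) ^ 3 = (r : R) := by linear_combination hρ + ρ ^ 3 * hω3
  have h₂ : (ω ^ 2 * ρ + 1 - 1) ^ 3 = (r : R) := by
    linear_combination hρ + ρ ^ 3 * (ω ^ 3 + 1) * hω3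
  induction n using pellY.induct with
  | case1 => simp only [pellY]; push_cast; linear_combination -hω
  | case2 => simp only [pellY]; push_cast; linear_combination -hω - ρ * ω * hω3
  | case3 =>
    simp only [pellY]
    push_cast
    linear_combination -hω - 2 * ρ * ω * hω3 - ρ ^ 2 * (hω + (ω ^ 3 + 1) * hω3)
  | case4 n ih₂ ih₁ ih₀ =>
    rw [pow_add_three_of_sub_one_pow_three h₀, pow_add_three_of_sub_one_pow_three h₁,
      pow_add_three_of_sub_one_pow_three h₂, pellY]
    push_cast
    linear_combination 3 * ih₂ - 3 * ih₁ + ((r : R) + 1) * ih₀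

theorem stmt_6 (r : ℤ) (hr : 0 < r) (ρ : ℝ) (hρ : ρ ^ 3 = (r : ℝ))
    (ω : ℂ) (hω : IsPrimitiveRoot ω 3) (n : ℕ) :
    (pellY r n : ℂ)
      = (((ρ : ℂ) + 1) ^ n * ω + (ω * (ρ : ℂ) + 1) ^ n + (ω ^ 2 * (ρ : ℂ) + 1) ^ n * ω ^ 2)
          / (3 * ω * (ρ : ℂ)) := by
  have hρ' : (ρ : ℂ) ^ 3 = r := by exact_mod_cast hρ
  have hρ0 : (ρ : ℂ) ≠ 0 := by
    rintro h
    rw [h, zero_pow three_ne_zero] at hρ'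
    exact hr.ne (by exact_mod_cast hρ')
  have hω0 : ω ≠ 0 := hω.ne_zero three_ne_zero
  have hsum : 1 + ω + ω ^ 2 = 0 := by
    simpa [Finset.sum_range_succ] using hω.geom_sum_eq_zero (by norm_num)
  rw [eq_div_iff (by simp [hρ0, hω0])]
  exact pellY_mul_eq r hρ' hsum n
end

section
/- Let r be a positive integer, let ρ be the real cube root of r, and let ω be a primitive complex cube root of unity. Then for every non-negative integer n, the Pell-Z sequence of parameter r satisfies the Binet formula Z_n(r) = ((ρ + 1)ⁿ·ω² + (ωρ + 1)ⁿ + (ω²ρ + 1)ⁿ·ω)/(3ω²ρ²) in ℂ. -/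
theorem pow_add_three_of_sub_one_pow_three_eq {R : Type*} [CommRing R] {x r : R}
    (h : (x - 1) ^ 3 = r) (n : ℕ) :
    x ^ (n + 3) = 3 * x ^ (n + 2) - 3 * x ^ (n + 1) + (r + 1) * x ^ n := by
  subst h
  ring

theorem pellZ_mul_eq {R : Type*} [CommRing R] {r : ℤ} {ρ ω : R} (hρ : ρ ^ 3 = r)
    (hω : 1 + ω + ω ^ 2 = 0) (n : ℕ) :
    (pellZ r n : R) * (3 * ω ^ 2 * ρ ^ 2)
      = (ρ + 1) ^ n * ω ^ 2 + (ω * ρ + 1) ^ n + (ω ^ 2 * ρ + 1) ^ n * ω := by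
  have hω3 : ω ^ 3 = 1 := by linear_combination (ω - 1) * hω
  induction n using pellZ.induct with
  | case1 => simp only [pellZ]; push_cast; linear_combination -hω
  | case2 => simp only [pellZ]; push_cast; linear_combination -(1 + ρ) * hω - ρ * hω3
  | case3 =>
    simp only [pellZ]
    push_cast
    linear_combination -(1 + 2 * ρ) * hω - (2 * ρ + ω ^ 2 * ρ ^ 2) * hω3
  | case4 n h₂ h₁ h₀ =>
    rw [pow_add_three_of_sub_one_pow_three_eq (x := ρ + 1) (r := (r : R))
        (by linear_combination hρ),
      pow_add_three_of_sub_one_pow_three_eq (x := ω * ρ + 1) (r := (r : R))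
        (by linear_combination ρ ^ 3 * hω3 + hρ),
      pow_add_three_of_sub_one_pow_three_eq (x := ω ^ 2 * ρ + 1) (r := (r : R))
        (by linear_combination ρ ^ 3 * (ω ^ 3 + 1) * hω3 + hρ), pellZ]
    push_cast
    linear_combination 3 * h₂ - 3 * h₁ + (r + 1 : R) * h₀

theorem stmt_7 (r : ℤ) (hr : 0 < r) (ρ : ℝ) (hρ : ρ ^ 3 = (r : ℝ))
    (ω : ℂ) (hω : IsPrimitiveRoot ω 3) (n : ℕ) :
    (pellZ r n : ℂ)
      = (((ρ : ℂ) + 1) ^ n * ω ^ 2 + (ω * (ρ : ℂ) + 1) ^ n + (ω ^ 2 * (ρ : ℂ) + 1) ^ n * ω)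
          / (3 * ω ^ 2 * (ρ : ℂ) ^ 2) := by
  have hρ0 : (ρ : ℂ) ≠ 0 := by
    rintro h
    have hr0 : (r : ℝ) = 0 := by rw [← hρ, Complex.ofReal_eq_zero.mp h]; norm_num
    exact hr.ne' (by exact_mod_cast hr0)
  have hω0 : ω ≠ 0 := hω.ne_zero (by norm_num)
  have hsum : 1 + ω + ω ^ 2 = 0 := by
    simpa [Finset.sum_range_succ] using hω.geom_sum_eq_zero (by norm_num)
  rw [eq_div_iff (by simp [hρ0, hω0])]
  exact pellZ_mul_eq (by exact_mod_cast congrArg Complex.ofReal hρ) hsum n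
end

section
/- Let p = 3k + 1 be a prime and let r be an integer whose residue modulo p is not a cube in the field with p elements. Then X_p(r) ≡ 1 (mod p), Y_p(r) ≡ r^k (mod p), and Z_p(r) ≡ 0 (mod p). -/
open Polynomial in
theorem eq_zero_of_root_X_pow_three_sub_C {R : Type*} [CommRing R] [Nontrivial R] {r a b c : R}
    (h : AdjoinRoot.of (X ^ 3 - C r) a + AdjoinRoot.of (X ^ 3 - C r) b * AdjoinRoot.root _ +
      AdjoinRoot.of (X ^ 3 - C r) c * AdjoinRoot.root _ ^ 2 = 0) :
    a = 0 ∧ b = 0 ∧ c = 0 := by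
  have hdvd : (X ^ 3 - C r) ∣ C c * X ^ 2 + C b * X + C a := by
    rw [← AdjoinRoot.mk_eq_zero, map_add, map_add, map_mul, map_mul, map_pow, AdjoinRoot.mk_C,
      AdjoinRoot.mk_C, AdjoinRoot.mk_C, AdjoinRoot.mk_X]
    linear_combination h
  have hzero : C c * X ^ 2 + C b * X + C a = 0 := by
    by_contra hne
    refine (monic_X_pow_sub_C r three_ne_zero).not_dvd_of_degree_lt hne ?_ hdvd
    rw [degree_X_pow_sub_C (by norm_num)]
    exact degree_quadratic_lt
  refine ⟨?_, ?_, ?_⟩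
  · simpa using congrArg (coeff · 0) hzero
  · simpa [coeff_X, coeff_C] using congrArg (coeff · 1) hzero
  · simpa [coeff_X, coeff_C] using congrArg (coeff · 2) hzero

theorem one_add_pow_eq_pell {R : Type*} [CommRing R] {t : R} {r : ℤ} (ht : t ^ 3 = r) (n : ℕ) :
    (1 + t) ^ n = pellX r n + pellY r n * t + pellZ r n * t ^ 2 := by
  induction n using Nat.strong_induction_on with
  | _ n ih =>
    match n with
    | 0 => simp [pellX, pellY, pellZ]
    | 1 => simp [pellX, pellY, pellZ]
    | 2 =>
      simp only [pellX, pellY, pellZ]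
      push_cast
      ring
    | n + 3 =>
      have h₀ := ih n (by omega)
      have h₁ := ih (n + 1) (by omega)
      have h₂ := ih (n + 2) (by omega)
      simp only [pellX, pellY, pellZ]
      push_cast
      linear_combination 3 * h₂ - 3 * h₁ + (r + 1 : R) * h₀ + (1 + t) ^ n * ht

theorem stmt_8 (p k : ℕ) (hp : p.Prime) (hpk : p = 3 * k + 1) (r : ℤ)
    (hr : ∀ b : ZMod p, b ^ 3 ≠ (r : ZMod p)) :
    pellX r p ≡ 1 [ZMOD (p : ℤ)] ∧ pellY r p ≡ r ^ k [ZMOD (p : ℤ)] ∧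
      pellZ r p ≡ 0 [ZMOD (p : ℤ)] := by
  have := Fact.mk hp
  set f : Polynomial (ZMod p) := Polynomial.X ^ 3 - Polynomial.C (r : ZMod p) with hf
  have : CharP (AdjoinRoot f) p := by
    have : Nontrivial (AdjoinRoot f) := by
      refine AdjoinRoot.nontrivial f ?_
      rw [hf, Polynomial.degree_X_pow_sub_C (by norm_num)]
      norm_num
    exact charP_of_injective_ringHom (AdjoinRoot.of f).injective p
  have ht : AdjoinRoot.root f ^ 3 = (r : AdjoinRoot f) := by
    have h := AdjoinRoot.eval₂_root f
    rwa [hf, Polynomial.eval₂_sub, Polynomial.eval₂_pow, Polynomial.eval₂_X, Polynomial.eval₂_C,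
      map_intCast, sub_eq_zero] at h
  have hfrob : (1 + AdjoinRoot.root f) ^ p = 1 + (r : AdjoinRoot f) ^ k * AdjoinRoot.root f := by
    rw [add_pow_char, one_pow, ← ht, ← pow_mul, ← pow_succ, ← hpk]
  have hpell := one_add_pow_eq_pell ht p
  obtain ⟨hX, hY, hZ⟩ := eq_zero_of_root_X_pow_three_sub_C (r := (r : ZMod p))
    (a := pellX r p - 1) (b := pellY r p - (r : ZMod p) ^ k) (c := pellZ r p) (by
      simp only [map_sub, map_one, map_pow, map_intCast]
      linear_combination hfrob - hpell)
  simp only [← ZMod.intCast_eq_intCast_iff]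
  push_cast
  exact ⟨sub_eq_zero.mp hX, sub_eq_zero.mp hY, hZ⟩
end

section
/- Let p = 3k + 1 be a prime and let r be an integer whose residue modulo p is not a cube in the field with p elements. Then X_{p²}(r) ≡ 1 (mod p), Y_{p²}(r) ≡ r^{2k} (mod p), and Z_{p²}(r) ≡ 0 (mod p). -/
theorem pell_succ (r : ℤ) : ∀ n : ℕ,
    pellX r (n + 1) = pellX r n + r * pellZ r n ∧
      pellY r (n + 1) = pellX r n + pellY r n ∧ pellZ r (n + 1) = pellY r n + pellZ r n
  | 0 => by simp [pellX, pellY, pellZ]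
  | 1 => by simp [pellX, pellY, pellZ]
  | 2 => by
    simp only [pellX, pellY, pellZ]
    refine ⟨?_, ?_, ?_⟩ <;> ring
  | n + 3 => by
    obtain ⟨hX₀, hY₀, hZ₀⟩ := pell_succ r n
    obtain ⟨hX₁, hY₁, hZ₁⟩ := pell_succ r (n + 1)
    obtain ⟨hX₂, hY₂, hZ₂⟩ := pell_succ r (n + 2)
    simp only [pellX, pellY, pellZ] at hX₂ hY₂ hZ₂ ⊢
    refine ⟨?_, ?_, ?_⟩
    · linear_combination 3 * hX₂ - 3 * hX₁ + (r + 1) * hX₀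
    · linear_combination 3 * hY₂ - 3 * hY₁ + (r + 1) * hY₀
    · linear_combination 3 * hZ₂ - 3 * hZ₁ + (r + 1) * hZ₀

/-- Multiplication by a cube root of `r`, in the basis of its powers `0`, `1`, `2`. -/
def cubeRootMatrix {R : Type*} [CommRing R] (r : R) : Matrix (Fin 3) (Fin 3) R :=
  !![0, 0, r; 1, 0, 0; 0, 1, 0]

theorem cubeRootMatrix_pow_three {R : Type*} [CommRing R] (r : R) :
    cubeRootMatrix r ^ 3 = r • (1 : Matrix (Fin 3) (Fin 3) R) := by
  ext i j
  fin_cases i <;> fin_cases j <;>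
    simp [cubeRootMatrix, pow_succ, Matrix.mul_apply, Fin.sum_univ_three]

theorem one_add_cubeRootMatrix_pow {R : Type*} [CommRing R] (r : ℤ) (n : ℕ) :
    (1 + cubeRootMatrix (r : R)) ^ n =
      !![(pellX r n : R), r * pellZ r n, r * pellY r n;
        (pellY r n : R), pellX r n, r * pellZ r n;
        (pellZ r n : R), pellY r n, pellX r n] := by
  induction n with
  | zero =>
    ext i j
    fin_cases i <;> fin_cases j <;> simp [pellX, pellY, pellZ]
  | succ n ih =>
    obtain ⟨hX, hY, hZ⟩ := pell_succ r n
    rw [pow_succ, ih, hX, hY, hZ]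
    ext i j
    fin_cases i <;> fin_cases j <;>
      simp [cubeRootMatrix, Matrix.mul_apply, Fin.sum_univ_three] <;> ring

theorem one_add_cubeRootMatrix_pow_sq {p k : ℕ} [Fact p.Prime] (hpk : p = 3 * k + 1)
    {r : ZMod p} (hr : r ≠ 0) :
    (1 + cubeRootMatrix r) ^ p ^ 2 = 1 + r ^ (2 * k) • cubeRootMatrix r := by
  have hexp : p ^ 2 = 3 * ((p - 1) * k + 2 * k) + 1 := by
    rw [hpk, Nat.add_sub_cancel]
    ring
  rw [add_pow_char_pow_of_commute p 2 (Commute.one_left _), one_pow, hexp, pow_succ, pow_mul,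
    cubeRootMatrix_pow_three, smul_pow, one_pow, pow_add, pow_mul, ZMod.pow_card_sub_one_eq_one hr,
    one_pow, one_mul, smul_one_mul]

theorem stmt_9 (p k : ℕ) (hp : p.Prime) (hpk : p = 3 * k + 1) (r : ℤ)
    (hr : ∀ b : ZMod p, b ^ 3 ≠ (r : ZMod p)) :
    pellX r (p ^ 2) ≡ 1 [ZMOD (p : ℤ)] ∧ pellY r (p ^ 2) ≡ r ^ (2 * k) [ZMOD (p : ℤ)] ∧
      pellZ r (p ^ 2) ≡ 0 [ZMOD (p : ℤ)] := by
  have : Fact p.Prime := ⟨hp⟩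
  have hr₀ : (r : ZMod p) ≠ 0 := fun h => hr 0 (by simp [h])
  have h := (one_add_cubeRootMatrix_pow r (p ^ 2)).symm.trans
    (one_add_cubeRootMatrix_pow_sq hpk hr₀)
  simp only [← ZMod.intCast_eq_intCast_iff]
  refine ⟨?_, ?_, ?_⟩
  · simpa [cubeRootMatrix] using congr_fun₂ h 0 0
  · simpa [cubeRootMatrix] using congr_fun₂ h 1 0
  · simpa [cubeRootMatrix] using congr_fun₂ h 2 0
end

section
/- Let p = 3k + 1 be a prime and let r be an element of the field 𝔽_p with p elements. In the quotient ring 𝔽_p[t]/(t³ − r), the element 1 + t satisfies (1 + t)^(p²) = 1 + r^{2k}·t. -/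
/-- In `R[t]/(t³ - r)` the root cubes to `r`. -/
theorem AdjoinRoot.root_X_pow_three_sub_C_pow_three {R : Type*} [CommRing R] (r : R) :
    AdjoinRoot.root (Polynomial.X ^ 3 - Polynomial.C r) ^ 3
      = AdjoinRoot.of (Polynomial.X ^ 3 - Polynomial.C r) r := by
  have h := AdjoinRoot.eval₂_root (Polynomial.X ^ 3 - Polynomial.C r)
  simpa [Polynomial.eval₂_sub, sub_eq_zero] using h

theorem stmt_15 (p k : ℕ) (hp : p.Prime) (hpk : p = 3 * k + 1) (r : ZMod p) :
    (1 + AdjoinRoot.root (Polynomial.X ^ 3 - Polynomial.C r)) ^ (p ^ 2)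
      = 1 + AdjoinRoot.of (Polynomial.X ^ 3 - Polynomial.C r) (r ^ (2 * k))
          * AdjoinRoot.root (Polynomial.X ^ 3 - Polynomial.C r) := by
  have : Fact p.Prime := ⟨hp⟩
  have hinj : Function.Injective (AdjoinRoot.of (Polynomial.X ^ 3 - Polynomial.C r)) := by
    apply AdjoinRoot.of.injective_of_degree_ne_zero
    rw [Polynomial.degree_X_pow_sub_C (by norm_num)]
    norm_num
  have : CharP (AdjoinRoot (Polynomial.X ^ 3 - Polynomial.C r)) p :=
    charP_of_injective_ringHom hinj p
  have hroot : AdjoinRoot.root (Polynomial.X ^ 3 - Polynomial.C r) ^ p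
      = AdjoinRoot.of (Polynomial.X ^ 3 - Polynomial.C r) (r ^ k)
          * AdjoinRoot.root (Polynomial.X ^ 3 - Polynomial.C r) := by
    refine (congrArg (_ ^ ·) hpk).trans ?_
    rw [pow_succ _ (3 * k), pow_mul, AdjoinRoot.root_X_pow_three_sub_C_pow_three, map_pow]
  rw [add_pow_char_pow, one_pow, sq, pow_mul, hroot, mul_pow, hroot, ← map_pow,
    ZMod.pow_card, ← mul_assoc, ← map_mul, ← pow_add, two_mul]
end

section
/- Let p = 3k + 2 be a prime with p > 3. Then the p-th power (x_p, y_p, z_p) of (1, 1, 0) under ×_2 satisfies the three necessary primality conditions: x_p ≡ 1 (mod p), y_p ≡ 0 (mod p), and z_p ≡ 2^k (mod p). -/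
section

open Polynomial

/-- Modulo `X ^ 3 - r`, the coordinates of `pellPow r n` are the coefficients of `(1 + X) ^ n`. -/
theorem X_pow_three_sub_dvd_one_add_X_pow_sub (R : Type*) [CommRing R] (r : ℤ) (n : ℕ) :
    (X ^ 3 - C (r : R)) ∣ (1 + X) ^ n - (C ((pellPow r n).2.2 : R) * X ^ 2 +
      C ((pellPow r n).2.1 : R) * X + C ((pellPow r n).1 : R)) := by
  induction n with
  | zero => simp [pellPow]
  | succ n ih =>
    obtain ⟨q, hq⟩ := ih
    refine ⟨(1 + X) * q + C ((pellPow r n).2.2 : R), ?_⟩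
    simp only [pellPow, pellMul]
    push_cast
    simp only [map_add, map_mul, map_zero, map_one]
    linear_combination (1 + X) * hq

/-- For a prime `p = 3 * k + 2`, the `p`-th power of `(1, 1, 0)` is `(1, 0, r ^ k)` modulo `p`. -/
theorem pellPow_prime_modEq (r : ℤ) {p k : ℕ} (hp : p.Prime) (hpk : p = 3 * k + 2) :
    (pellPow r p).1 ≡ 1 [ZMOD (p : ℤ)] ∧
    (pellPow r p).2.1 ≡ 0 [ZMOD (p : ℤ)] ∧
    (pellPow r p).2.2 ≡ r ^ k [ZMOD (p : ℤ)] := by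
  have : Fact p.Prime := ⟨hp⟩
  have hpow := X_pow_three_sub_dvd_one_add_X_pow_sub (ZMod p) r p
  simp only [← ZMod.intCast_eq_intCast_iff]
  generalize pellPow r p = v at hpow ⊢
  have hX : (X ^ 3 - C (r : ZMod p)) ∣ X ^ p - C ((r : ZMod p) ^ k) * X ^ 2 := by
    have h := (sub_dvd_pow_sub_pow (X ^ 3) (C (r : ZMod p)) k).mul_right (X ^ 2)
    rwa [sub_mul, ← pow_mul, ← pow_add, ← hpk, ← C_pow] at h
  have hdvd : (X ^ 3 - C (r : ZMod p)) ∣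
      C ((v.2.2 : ZMod p) - (r : ZMod p) ^ k) * X ^ 2 + C (v.2.1 : ZMod p) * X +
        C ((v.1 : ZMod p) - 1) := by
    convert hX.sub hpow using 1
    rw [add_pow_char, one_pow]
    simp only [map_sub, map_one]
    ring
  have hzero := eq_zero_of_dvd_of_degree_lt hdvd <| by
    rw [degree_X_pow_sub_C three_pos]
    exact degree_quadratic_lt
  have h0 := congrArg (coeff · 0) hzero
  have h1 := congrArg (coeff · 1) hzero
  have h2 := congrArg (coeff · 2) hzero
  simp only [coeff_add, coeff_C_mul, coeff_X_pow, coeff_X, coeff_C, coeff_zero] at h0 h1 h2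
  norm_num at h0 h1 h2
  push_cast
  exact ⟨sub_eq_zero.mp h0, h1, sub_eq_zero.mp h2⟩

end

theorem stmt_19 (p k : ℕ) (hp : p.Prime) (hp3 : 3 < p) (hpk : p = 3 * k + 2) :
    (pellPow 2 p).1 ≡ 1 [ZMOD (p : ℤ)] ∧
    (pellPow 2 p).2.1 ≡ 0 [ZMOD (p : ℤ)] ∧
    (pellPow 2 p).2.2 ≡ 2 ^ k [ZMOD (p : ℤ)] := by
  exact pellPow_prime_modEq 2 hp hpk
end
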